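/- arXiv:1202.3538 — 4 statements merged into one kernel-verified Lean document; each statement's English description precedes it below -/
import Mathlib

section
/- For every agent a, the a-refinement relation ⪰_a on pointed models is reflexive and transitive (a pre-order), and satisfies the Church–Rosser property: if N_t ⪰_a M_s and N_t ⪰_a M'_{s'}, then there exists a pointed model N'_{t'} such that M_s ⪰_a N'_{t'} and M'_{s'} ⪰_a N'_{t'}. -/
/-- A Kripke model over agents `A` and propositional variables `P`. -/
structure KModel (A P : Type) where
  S : Type
  R : A → S → S → Prop
  V : P → S → Prop

/-- `Refines B M s N t` holds iff there is a `B`-refinement from the pointed model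
`M_s` to the pointed model `N_t`: a (nonempty) relation containing `(s, t)` satisfying
**atoms** and **back-a** for all agents `a ∈ A`, and **forth-a** for all `a ∉ B`. -/
def Refines {A P : Type} (B : Set A) (M : KModel A P) (s : M.S)
    (N : KModel A P) (t : N.S) : Prop :=
  ∃ Z : M.S → N.S → Prop,
    Z s t ∧
    (∀ u v, Z u v → ∀ p, M.V p u ↔ N.V p v) ∧
    (∀ a : A, ∀ u v, Z u v → ∀ v', N.R a v v' → ∃ u', M.R a u u' ∧ Z u' v') ∧
    (∀ a : A, a ∉ B → ∀ u v, Z u v → ∀ u', M.R a u u' → ∃ v', N.R a v v' ∧ Z u' v')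

/-- The model obtained from `N` by deleting every edge of agents in `B`. -/
def KModel.deleteEdges {A P : Type} (B : Set A) (N : KModel A P) : KModel A P where
  S := N.S
  R b x y := b ∉ B ∧ N.R b x y
  V := N.V

theorem Refines.refl {A P : Type} (B : Set A) (M : KModel A P) (s : M.S) :
    Refines B M s M s := by
  refine ⟨Eq, rfl, ?_, ?_, ?_⟩
  · rintro u _ rfl p
    rfl
  · rintro b u _ rfl v h
    exact ⟨v, h, rfl⟩
  · rintro b _ u _ rfl v h
    exact ⟨v, h, rfl⟩

theorem Refines.trans {A P : Type} {B : Set A} {M N O : KModel A P} {s : M.S} {t : N.S}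
    {u : O.S} (h₁ : Refines B M s N t) (h₂ : Refines B N t O u) : Refines B M s O u := by
  obtain ⟨Z, hZ, atomsZ, backZ, forthZ⟩ := h₁
  obtain ⟨W, hW, atomsW, backW, forthW⟩ := h₂
  refine ⟨fun x z => ∃ y, Z x y ∧ W y z, ⟨t, hZ, hW⟩, ?_, ?_, ?_⟩
  · rintro x z ⟨y, hxy, hyz⟩ p
    exact (atomsZ x y hxy p).trans (atomsW y z hyz p)
  · rintro b x z ⟨y, hxy, hyz⟩ z' hz
    obtain ⟨y', hy, hyz'⟩ := backW b y z hyz z' hz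
    obtain ⟨x', hx, hxy'⟩ := backZ b x y hxy y' hy
    exact ⟨x', hx, y', hxy', hyz'⟩
  · rintro b hb x z ⟨y, hxy, hyz⟩ x' hx
    obtain ⟨y', hy, hxy'⟩ := forthZ b hb x y hxy x' hx
    obtain ⟨z', hz, hyz'⟩ := forthW b hb y z hyz y' hy
    exact ⟨z', hz, y', hxy', hyz'⟩

/-- Every `B`-refinement of `N` is in turn `B`-refined by `N` with all its `B`-edges deleted. -/
theorem Refines.deleteEdges {A P : Type} {B : Set A} {N M : KModel A P} {t : N.S} {s : M.S}
    (h : Refines B N t M s) : Refines B M s (N.deleteEdges B) t := by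
  obtain ⟨Z, hZ, atoms, back, forth⟩ := h
  refine ⟨fun y x => Z x y, hZ, ?_, ?_, ?_⟩
  · intro y x hxy p
    exact (atoms x y hxy p).symm
  · rintro b y x hxy x' ⟨hb, hx⟩
    exact forth b hb x y hxy x' hx
  · intro b hb y x hxy y' hy
    obtain ⟨x', hx, hxy'⟩ := back b x y hxy y' hy
    exact ⟨x', ⟨hb, hx⟩, hxy'⟩

/-- For every agent `a`, the `a`-refinement relation on pointed models is reflexive and
transitive, and satisfies the Church–Rosser property. -/
theorem refines_refl_trans_churchRosser {A P : Type} (a : A) :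
    (∀ (M : KModel A P) (s : M.S), Refines {a} M s M s) ∧
    (∀ (M : KModel A P) (s : M.S) (N : KModel A P) (t : N.S) (O : KModel A P) (u : O.S),
      Refines {a} M s N t → Refines {a} N t O u → Refines {a} M s O u) ∧
    (∀ (N : KModel A P) (t : N.S) (M : KModel A P) (s : M.S)
        (M' : KModel A P) (s' : M'.S),
      Refines {a} N t M s → Refines {a} N t M' s' →
      ∃ (N' : KModel A P) (t' : N'.S),
        Refines {a} M s N' t' ∧ Refines {a} M' s' N' t') := by
  exact ⟨fun M s => .refl {a} M s, fun _ _ _ _ _ _ h₁ h₂ => h₁.trans h₂,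
    fun N t _ _ _ _ h h' => ⟨N.deleteEdges {a}, t, h.deleteEdges, h'.deleteEdges⟩⟩
end

section
/- If M_s ⪰_a N_t, then there exist a model N' with a designated state t' and a relation R''_a ⊆ R^{N'}_a such that M_s ≃ N'_{t'} and, writing N'' for the model obtained from N' by replacing R^{N'}_a with R''_a (leaving all other accessibility relations and the valuation unchanged), N''_{t'} ≃ N_t. -/
/-- `Bisim M s N t`: there is a bisimulation between `M` and `N` linking `s` and `t`. -/
def Bisim {A P : Type} (M : KModel A P) (s : M.S) (N : KModel A P) (t : N.S) : Prop :=
  ∃ Z : M.S → N.S → Prop,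
    Z s t ∧
    (∀ u v, Z u v → ∀ p, M.V p u ↔ N.V p v) ∧
    (∀ a : A, ∀ u v, Z u v → ∀ u', M.R a u u' → ∃ v', N.R a v v' ∧ Z u' v') ∧
    (∀ a : A, ∀ u v, Z u v → ∀ v', N.R a v v' → ∃ u', M.R a u u' ∧ Z u' v')

/-- Refinement is bisimulation plus removal of `a`-arrows: if `M_s ⪰_a N_t` then there
are `N'_{t'}` and `R''_a ⊆ R^{N'}_a` with `M_s ≃ N'_{t'}` and, replacing the `a`-relation
of `N'` by `R''_a` (everything else unchanged), the resulting pointed model is bisimilar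
to `N_t`. -/
theorem refines_eq_bisim_plus_restriction {A P : Type} [DecidableEq A] (a : A)
    (M : KModel A P) (s : M.S) (N : KModel A P) (t : N.S)
    (h : Refines {a} M s N t) :
    ∃ (N' : KModel A P) (t' : N'.S) (R'' : N'.S → N'.S → Prop),
      (∀ u v, R'' u v → N'.R a u v) ∧
      Bisim M s N' t' ∧
      Bisim ⟨N'.S, fun b => if b = a then R'' else N'.R b, N'.V⟩ t' N t := by
  obtain ⟨Z, hst, atoms, back, forth⟩ := h
  -- Pairs in the refinement, plus a copy of `M` receiving the removable `a`-arrows.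
  let proj : {p : M.S × N.S // Z p.1 p.2} ⊕ M.S → M.S := Sum.elim (fun p => p.1.1) id
  let R' : A → {p : M.S × N.S // Z p.1 p.2} ⊕ M.S → {p : M.S × N.S // Z p.1 p.2} ⊕ M.S → Prop :=
    fun b x y => M.R b (proj x) (proj y) ∧
      match x, y with
      | .inl p, .inl q => N.R b p.1.2 q.1.2
      | .inl _, .inr _ => b = a
      | .inr _, .inl _ => False
      | .inr _, .inr _ => True
  refine ⟨⟨_, R', fun p x => M.V p (proj x)⟩, .inl ⟨(s, t), hst⟩,
    fun x y => R' a x y ∧ y.isLeft, fun _ _ h => h.1,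
    ⟨fun u x => proj x = u, rfl, ?_, ?_, ?_⟩,
    ⟨fun x v => ∃ p : {p : M.S × N.S // Z p.1 p.2}, x = .inl p ∧ p.1.2 = v,
      ⟨_, rfl, rfl⟩, ?_, ?_, ?_⟩⟩
  · rintro _ x rfl p
    rfl
  · rintro b _ (⟨⟨u, v⟩, huv⟩ | u) rfl u' hu
    · by_cases hb : b = a
      · exact ⟨.inr u', ⟨hu, hb⟩, rfl⟩
      · obtain ⟨v', hv, hZ⟩ := forth b hb u v huv u' hu
        exact ⟨.inl ⟨(u', v'), hZ⟩, ⟨hu, hv⟩, rfl⟩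
    · exact ⟨.inr u', ⟨hu, trivial⟩, rfl⟩
  · rintro b _ x rfl y hy
    exact ⟨proj y, hy.1, rfl⟩
  · rintro _ _ ⟨p, rfl, rfl⟩ q
    exact atoms _ _ p.2 q
  · rintro b _ _ ⟨p, rfl, rfl⟩ y hy
    dsimp only at hy
    split_ifs at hy with hb
    · subst hb
      rcases y with q | u
      · exact ⟨q.1.2, hy.1.2, q, rfl, rfl⟩
      · exact absurd hy.2 (by simp)
    · rcases y with q | u
      · exact ⟨q.1.2, hy.2, q, rfl, rfl⟩
      · exact absurd hy.2 hb
  · rintro b _ _ ⟨p, rfl, rfl⟩ v' hv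
    obtain ⟨u', hu, hZ⟩ := back b _ _ p.2 v' hv
    refine ⟨.inl ⟨(u', v'), hZ⟩, ?_, _, rfl, rfl⟩
    dsimp only
    split_ifs with hb
    · subst hb
      exact ⟨⟨hu, hv⟩, rfl⟩
    · exact ⟨hu, hv⟩
end

section
/- In the axiomatization RML, for every agent a ∈ A: (1) ⊢ ∀_a φ ↔ φ for every propositional formula φ; (2) ⊢ ∃_a φ ↔ φ for every propositional formula φ; (3) ⊢ (φ ∧ ∃_a ψ) ↔ ∃_a (φ ∧ ψ) for every propositional formula φ and every formula ψ of L_∀. -/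
/-- The language `L_∀` of refinement modal logic. -/
inductive RForm (A P : Type) : Type where
  | atom : P → RForm A P
  | neg : RForm A P → RForm A P
  | and : RForm A P → RForm A P → RForm A P
  | box : A → RForm A P → RForm A P
  | rall : A → RForm A P → RForm A P

/-- Satisfaction for refinement modal logic. -/
def Sat {A P : Type} : (M : KModel A P) → M.S → RForm A P → Prop
  | M, s, .atom p => M.V p s
  | M, s, .neg φ => ¬ Sat M s φ
  | M, s, .and φ ψ => Sat M s φ ∧ Sat M s ψ
  | M, s, .box a φ => ∀ t, M.R a s t → Sat M t φ
  | M, s, .rall a φ => ∀ (N : KModel A P) (t : N.S), Refines {a} M s N t → Sat N t φ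

/-- Material implication `φ → ψ`, as an abbreviation. -/
def fimp {A P : Type} (φ ψ : RForm A P) : RForm A P := .neg (.and φ (.neg ψ))

/-- Biimplication `φ ↔ ψ`, as an abbreviation. -/
def fiff {A P : Type} (φ ψ : RForm A P) : RForm A P := .and (fimp φ ψ) (fimp ψ φ)

/-- `◇_a φ := ¬□_a ¬φ`. -/
def fdia {A P : Type} (a : A) (φ : RForm A P) : RForm A P := .neg (.box a (.neg φ))

/-- `∃_a φ := ¬∀_a ¬φ`. -/
def fex {A P : Type} (a : A) (φ : RForm A P) : RForm A P := .neg (.rall a (.neg φ))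

/-- A formula is valid iff it is true at every pointed model. -/
def Valid {A P : Type} (φ : RForm A P) : Prop :=
  ∀ (M : KModel A P) (s : M.S), Sat M s φ

/-- `⊥` (using a fixed propositional variable). -/
def fbot {A P : Type} [Inhabited P] : RForm A P :=
  .and (.atom default) (.neg (.atom default))

/-- `⊤`. -/
def ftop {A P : Type} [Inhabited P] : RForm A P := .neg fbot

/-- Disjunction, as an abbreviation. -/
def forr {A P : Type} (φ ψ : RForm A P) : RForm A P := .neg (.and (.neg φ) (.neg ψ))

/-- Big disjunction `⋁ Φ` of a finite list of formulas (`⋁ ∅ = ⊥`). -/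
def disjList {A P : Type} [Inhabited P] : List (RForm A P) → RForm A P
  | [] => fbot
  | [φ] => φ
  | φ :: ψ :: l => forr φ (disjList (ψ :: l))

/-- Big conjunction `⋀ Φ` of a finite list of formulas (`⋀ ∅ = ⊤`). -/
def conjList {A P : Type} [Inhabited P] : List (RForm A P) → RForm A P
  | [] => ftop
  | [φ] => φ
  | φ :: ψ :: l => .and φ (conjList (ψ :: l))

/-- The cover operator `∇_a Φ := □_a ⋁ Φ ∧ ⋀_{φ ∈ Φ} ◇_a φ`. -/
def cover {A P : Type} [Inhabited P] (a : A) (l : List (RForm A P)) : RForm A P :=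
  .and (.box a (disjList l)) (conjList (l.map (fdia a)))

/-- Propositional evaluation treating atoms, boxes and refinement quantifiers as
propositional atoms. -/
def pEval {A P : Type} (v : RForm A P → Prop) : RForm A P → Prop
  | .neg φ => ¬ pEval v φ
  | .and φ ψ => pEval v φ ∧ pEval v ψ
  | .atom p => v (.atom p)
  | .box a φ => v (.box a φ)
  | .rall a φ => v (.rall a φ)

/-- `φ` is a substitution instance of a propositional tautology. -/
def Taut {A P : Type} (φ : RForm A P) : Prop := ∀ v, pEval v φ

/-- Derivability in the axiomatization **RML**. -/
inductive Deriv {A P : Type} [Inhabited P] : RForm A P → Prop where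
  /-- **Prop**: all (substitution instances of) propositional tautologies. -/
  | prop {φ} : Taut φ → Deriv φ
  /-- **K**. -/
  | axK (a : A) (φ ψ : RForm A P) :
      Deriv (fimp (.box a (fimp φ ψ)) (fimp (.box a φ) (.box a ψ)))
  /-- **R**. -/
  | axR (a : A) (φ ψ : RForm A P) :
      Deriv (fimp (.rall a (fimp φ ψ)) (fimp (.rall a φ) (.rall a ψ)))
  /-- **RProp**, positive half. -/
  | axRProp1 (a : A) (p : P) : Deriv (fiff (.rall a (.atom p)) (.atom p))
  /-- **RProp**, negative half. -/
  | axRProp2 (a : A) (p : P) :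
      Deriv (fiff (.rall a (.neg (.atom p))) (.neg (.atom p)))
  /-- **RK**: `∃_a ∇_a Φ ↔ ⋀_{φ∈Φ} ◇_a ∃_a φ`. -/
  | axRK (a : A) (Φ : List (RForm A P)) :
      Deriv (fiff (fex a (cover a Φ))
        (conjList (Φ.map (fun φ => fdia a (fex a φ)))))
  /-- **RKmulti**: `∃_a ∇_b Φ ↔ ∇_b (∃_a Φ)` for `b ≠ a`. -/
  | axRKmulti (a b : A) (hba : b ≠ a) (Φ : List (RForm A P)) :
      Deriv (fiff (fex a (cover b Φ)) (cover b (Φ.map (fex a))))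
  /-- **RKconj**: `∃_a ⋀_{b∈B} ∇_b Φᵇ ↔ ⋀_{b∈B} ∃_a ∇_b Φᵇ` for `B ⊆ A`. -/
  | axRKconj (a : A) (L : List (A × List (RForm A P)))
      (hB : (L.map Prod.fst).Nodup) :
      Deriv (fiff (fex a (conjList (L.map (fun bl => cover bl.1 bl.2))))
        (conjList (L.map (fun bl => fex a (cover bl.1 bl.2)))))
  /-- **MP**. -/
  | mp {φ ψ} : Deriv (fimp φ ψ) → Deriv φ → Deriv ψ
  /-- **NecK**. -/
  | necK (a : A) {φ} : Deriv φ → Deriv (.box a φ)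
  /-- **NecR**. -/
  | necR (a : A) {φ} : Deriv φ → Deriv (.rall a φ)

/-- A propositional formula: built from variables of `P` using only `¬` and `∧`. -/
def IsPropForm {A P : Type} : RForm A P → Prop
  | .atom _ => True
  | .neg φ => IsPropForm φ
  | .and φ ψ => IsPropForm φ ∧ IsPropForm ψ
  | .box _ _ => False
  | .rall _ _ => False

namespace Deriv

variable {A P : Type} [Inhabited P] {φ ψ χ θ : RForm A P}

theorem taut_mp (h : Taut (fimp φ ψ)) (hφ : Deriv φ) : Deriv ψ :=
  .mp (.prop h) hφ

theorem taut_mp₂ (h : Taut (fimp φ (fimp ψ χ))) (hφ : Deriv φ) (hψ : Deriv ψ) : Deriv χ :=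
  .mp (taut_mp h hφ) hψ

theorem taut_mp₃ (h : Taut (fimp φ (fimp ψ (fimp χ θ)))) (hφ : Deriv φ) (hψ : Deriv ψ)
    (hχ : Deriv χ) : Deriv θ :=
  .mp (taut_mp₂ h hφ hψ) hχ

theorem fimp_trans (h₁ : Deriv (fimp φ ψ)) (h₂ : Deriv (fimp ψ χ)) : Deriv (fimp φ χ) :=
  taut_mp₂ (by intro v; simp only [fimp, pEval]; tauto) h₁ h₂

theorem rall_mono (a : A) (h : Taut (fimp φ ψ)) : Deriv (fimp (.rall a φ) (.rall a ψ)) :=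
  .mp (.axR a φ ψ) (.necR a (.prop h))

theorem rall_mono₂ (a : A) (h : Taut (fimp φ (fimp ψ χ))) :
    Deriv (fimp (.rall a φ) (fimp (.rall a ψ) (.rall a χ))) :=
  fimp_trans (rall_mono a h) (.axR a ψ χ)

/-- The refinement quantifier is serial: `∀_a φ` and `∀_a ¬φ` exclude each other. -/
theorem rall_consistent (a : A) (φ : RForm A P) :
    Deriv (fimp (.rall a φ) (.neg (.rall a (.neg φ)))) := by
  have explosion (χ : RForm A P) :
      Deriv (fimp (.rall a φ) (fimp (.rall a (.neg φ)) (.rall a χ))) :=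
    rall_mono₂ a (by intro v; simp only [fimp, pEval]; tauto)
  have contradiction : Deriv (fimp (.rall a φ)
      (fimp (.rall a (.neg φ)) (.and (.atom default) (.neg (.atom default))))) := by
    have h₁ := taut_mp₂ (χ := fimp (.rall a φ) (fimp (.rall a (.neg φ)) (.atom default)))
      (by intro v; simp only [fimp, fiff, pEval]; tauto)
      (explosion (.atom default)) (.axRProp1 a default)
    exact taut_mp₃ (by intro v; simp only [fimp, fiff, pEval]; tauto)
      h₁ (explosion (.neg (.atom default))) (.axRProp2 a default)
  exact taut_mp (by intro v; simp only [fimp, pEval]; tauto) contradiction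

/-- Truth and falsity of a propositional formula are both preserved by refinements. -/
theorem rall_of_isPropForm (a : A) : ∀ {φ : RForm A P}, IsPropForm φ →
    Deriv (fimp φ (.rall a φ)) ∧ Deriv (fimp (.neg φ) (.rall a (.neg φ)))
  | .atom p, _ =>
    ⟨taut_mp (by intro v; simp only [fimp, fiff, pEval]; tauto) (.axRProp1 a p),
      taut_mp (by intro v; simp only [fimp, fiff, pEval]; tauto) (.axRProp2 a p)⟩
  | .neg φ, hφ => by
    obtain ⟨hpos, hneg⟩ := rall_of_isPropForm a (φ := φ) hφ
    have h : Deriv (fimp (.rall a φ) (.rall a (.neg (.neg φ)))) :=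
      rall_mono a (by intro v; simp only [fimp, pEval]; tauto)
    exact ⟨hneg, taut_mp₂ (by intro v; simp only [fimp, pEval]; tauto) hpos h⟩
  | .and φ ψ, hφψ => by
    obtain ⟨hφ, hφ'⟩ := rall_of_isPropForm a (φ := φ) hφψ.1
    obtain ⟨hψ, hψ'⟩ := rall_of_isPropForm a (φ := ψ) hφψ.2
    have h : Deriv (fimp (.rall a φ) (fimp (.rall a ψ) (.rall a (.and φ ψ)))) :=
      rall_mono₂ a (by intro v; simp only [fimp, pEval]; tauto)
    have h₁ : Deriv (fimp (.neg φ) (.rall a (.neg (.and φ ψ)))) :=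
      fimp_trans hφ' (rall_mono a (by intro v; simp only [fimp, pEval]; tauto))
    have h₂ : Deriv (fimp (.neg ψ) (.rall a (.neg (.and φ ψ)))) :=
      fimp_trans hψ' (rall_mono a (by intro v; simp only [fimp, pEval]; tauto))
    exact ⟨taut_mp₃ (by intro v; simp only [fimp, pEval]; tauto) hφ hψ h,
      taut_mp₂ (by intro v; simp only [fimp, pEval]; tauto) h₁ h₂⟩

theorem rall_iff_of_isPropForm (a : A) (hφ : IsPropForm φ) :
    Deriv (fiff (.rall a φ) φ) := by
  obtain ⟨hpos, hneg⟩ := rall_of_isPropForm a hφ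
  exact taut_mp₃ (by intro v; simp only [fimp, fiff, pEval]; tauto)
    hpos hneg (rall_consistent a φ)

theorem fex_iff_of_isPropForm (a : A) (hφ : IsPropForm φ) : Deriv (fiff (fex a φ) φ) :=
  taut_mp (by intro v; simp only [fimp, fiff, fex, pEval]; tauto)
    (rall_iff_of_isPropForm a (φ := .neg φ) hφ)

theorem and_fex_iff_of_isPropForm (a : A) (ψ : RForm A P) (hφ : IsPropForm φ) :
    Deriv (fiff (.and φ (fex a ψ)) (fex a (.and φ ψ))) := by
  obtain ⟨hpos, hneg⟩ := rall_of_isPropForm a hφ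
  have h : Deriv (fimp φ (fimp (.rall a (.neg (.and φ ψ))) (.rall a (.neg ψ)))) :=
    fimp_trans hpos (rall_mono₂ a (by intro v; simp only [fimp, pEval]; tauto))
  have h₁ : Deriv (fimp (.neg φ) (.rall a (.neg (.and φ ψ)))) :=
    fimp_trans hneg (rall_mono a (by intro v; simp only [fimp, pEval]; tauto))
  have h₂ : Deriv (fimp (.rall a (.neg ψ)) (.rall a (.neg (.and φ ψ)))) :=
    rall_mono a (by intro v; simp only [fimp, pEval]; tauto)
  exact taut_mp₃ (by intro v; simp only [fimp, fiff, fex, pEval]; tauto) h h₁ h₂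

end Deriv

/-- For every agent `a`: (1) `⊢ ∀_a φ ↔ φ` and (2) `⊢ ∃_a φ ↔ φ` for propositional `φ`,
and (3) `⊢ (φ ∧ ∃_a ψ) ↔ ∃_a (φ ∧ ψ)` for propositional `φ` and arbitrary `ψ`. -/
theorem RML_propositional_theorems {A P : Type} [Inhabited P] (a : A) :
    (∀ φ : RForm A P, IsPropForm φ → Deriv (fiff (.rall a φ) φ)) ∧
    (∀ φ : RForm A P, IsPropForm φ → Deriv (fiff (fex a φ) φ)) ∧
    (∀ (φ ψ : RForm A P), IsPropForm φ →
      Deriv (fiff (.and φ (fex a ψ)) (fex a (.and φ ψ)))) := by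
  exact ⟨fun _ => Deriv.rall_iff_of_isPropForm a, fun _ => Deriv.fex_iff_of_isPropForm a,
    fun _ ψ => Deriv.and_fex_iff_of_isPropForm a ψ⟩
end

section
/- Refinement modal logic is equally expressive as basic modal logic: every formula of L_∀ is logically equivalent to a formula of L (the ∀-free fragment), i.e. for every φ ∈ L_∀ there exists ψ ∈ L such that φ and ψ are true at exactly the same pointed models. -/
/-- The formula contains no refinement quantifier `∀_a` (i.e. it belongs to `L`). -/
def rallFree {A P : Type} : RForm A P → Prop
  | .atom _ => True
  | .neg φ => rallFree φ
  | .and φ ψ => rallFree φ ∧ rallFree ψ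
  | .box _ φ => rallFree φ
  | .rall _ _ => False

/-- `n`-bisimilarity of pointed models, restricted to the variables in `Q` and the agents in `B`. -/
def NBisim {A P : Type} (Q : Set P) (B : Set A) (M N : KModel A P) : ℕ → M.S → N.S → Prop
  | 0, s, t => ∀ p ∈ Q, M.V p s ↔ N.V p t
  | n + 1, s, t =>
    (∀ p ∈ Q, M.V p s ↔ N.V p t) ∧
    ∀ b ∈ B, (∀ s', M.R b s s' → ∃ t', N.R b t t' ∧ NBisim Q B M N n s' t') ∧
      (∀ t', N.R b t t' → ∃ s', M.R b s s' ∧ NBisim Q B M N n s' t')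

theorem NBisim.atoms {A P : Type} {Q : Set P} {B : Set A} {M N : KModel A P} {n : ℕ}
    {s : M.S} {t : N.S} (h : NBisim Q B M N n s t) : ∀ p ∈ Q, M.V p s ↔ N.V p t := by
  cases n with
  | zero => exact h
  | succ n => exact h.1

theorem NBisim.symm {A P : Type} {Q : Set P} {B : Set A} {M N : KModel A P} {n : ℕ}
    {s : M.S} {t : N.S} (h : NBisim Q B M N n s t) : NBisim Q B N M n t s := by
  induction n generalizing s t with
  | zero => exact fun p hp => (h p hp).symm
  | succ n ih =>
    refine ⟨fun p hp => (h.1 p hp).symm, fun b hb => ⟨fun t' ht => ?_, fun s' hs => ?_⟩⟩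
    · obtain ⟨s', hs, hst⟩ := (h.2 b hb).2 t' ht
      exact ⟨s', hs, ih hst⟩
    · obtain ⟨t', ht, hst⟩ := (h.2 b hb).1 s' hs
      exact ⟨t', ht, ih hst⟩

/-- Transitions between the second components of the states of `transferModel`. -/
inductive TransferStep {A P : Type} (B : Set A) (N : KModel A P) (b : A) :
    Option (N.S × ℕ) → Option (N.S × ℕ) → Prop
  | idle : TransferStep B N b none none
  | exhausted (v : N.S) : TransferStep B N b (some (v, 0)) none
  | leave (v : N.S) (k : ℕ) : b ∉ B → TransferStep B N b (some (v, k)) none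
  | follow (v w : N.S) (k : ℕ) : b ∈ B → N.R b v w →
      TransferStep B N b (some (v, k + 1)) (some (w, k))

/-- A state `x` of `transferModel` is coherent if its second component, when it is `some (v, k)`,
is `Z`-related to a state of `M` that is `k`-bisimilar to the first component of `x`. -/
def TransferCoherent {A P : Type} (Q : Set P) (B : Set A) {M M' N : KModel A P}
    (Z : M.S → N.S → Prop) (x : M'.S × Option (N.S × ℕ)) : Prop :=
  ∀ v k, x.2 = some (v, k) → ∃ u, Z u v ∧ NBisim Q B M M' k u x.1

/-- The model that follows `M'` while imitating `N` for as many steps as its counter allows,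
and continues as a copy of `M'` afterwards. -/
def transferModel {A P : Type} (Q : Set P) (B : Set A) {M : KModel A P} (M' : KModel A P)
    {N : KModel A P} (Z : M.S → N.S → Prop) : KModel A P where
  S := M'.S × Option (N.S × ℕ)
  R b x y := M'.R b x.1 y.1 ∧ TransferCoherent Q B Z y ∧ TransferStep B N b x.2 y.2
  V p x := M'.V p x.1

/-- Refinements can be transferred along `n`-bisimilarity. -/
theorem NBisim.transfer_refines {A P : Type} {Q : Set P} {B : Set A} {M M' N : KModel A P} {n : ℕ}
    {C : Set A} {s : M.S} {s' : M'.S} {t : N.S} (h : NBisim Q B M M' n s s')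
    (hr : Refines C M s N t) :
    ∃ (N' : KModel A P) (t' : N'.S), Refines C M' s' N' t' ∧ NBisim Q B N N' n t t' := by
  obtain ⟨Z, hst, hV, hback, hforth⟩ := hr
  refine ⟨transferModel Q B M' Z, (s', some (t, n)),
    ⟨fun u x => x.1 = u ∧ TransferCoherent Q B Z x, ⟨rfl, ?_⟩, ?_, ?_, ?_⟩, ?_⟩
  · rintro v k ⟨⟩
    exact ⟨s, hst, h⟩
  · rintro u x ⟨rfl, -⟩ p
    exact Iff.rfl
  · rintro b u x ⟨rfl, -⟩ y ⟨hR, hy, -⟩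
    exact ⟨y.1, hR, rfl, hy⟩
  · rintro b hb _ ⟨u, o⟩ ⟨rfl, hx⟩ w hw
    have leave : TransferStep B N b o none →
        ∃ y, (transferModel Q B M' Z).R b (u, o) y ∧ y.1 = w ∧ TransferCoherent Q B Z y := by
      intro hs
      have hc : TransferCoherent (N := N) Q B Z (w, none) := by rintro v k ⟨⟩
      exact ⟨(w, none), ⟨hw, hc, hs⟩, rfl, hc⟩
    rcases o with _ | ⟨v, _ | k⟩
    · exact leave .idle
    · exact leave (.exhausted v)
    · by_cases hbB : b ∈ B
      · obtain ⟨m, hm, hmu⟩ := hx v (k + 1) rfl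
        obtain ⟨m', hmm', hm'w⟩ := (hmu.2 b hbB).2 w hw
        obtain ⟨v', hv', hz⟩ := hforth b hb m v hm m' hmm'
        have hc : TransferCoherent (N := N) Q B Z (w, some (v', k)) := by
          rintro _ _ ⟨⟩
          exact ⟨m', hz, hm'w⟩
        exact ⟨(w, some (v', k)), ⟨hw, hc, .follow v v' k hbB hv'⟩, rfl, hc⟩
      · exact leave (.leave v _ hbB)
  · clear hforth
    induction n generalizing s s' t with
    | zero => exact fun p hp => (hV s t hst p).symm.trans (h p hp)
    | succ n ih =>
      refine ⟨fun p hp => (hV s t hst p).symm.trans (h.1 p hp), fun b hb => ⟨?_, ?_⟩⟩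
      · intro v hv
        obtain ⟨u, hu, huv⟩ := hback b s t hst v hv
        obtain ⟨u', hu', huu'⟩ := (h.2 b hb).1 u hu
        refine ⟨(u', some (v, n)), ⟨hu', ?_, .follow t v n hb hv⟩, ih huu' huv⟩
        rintro _ _ ⟨⟩
        exact ⟨u, huv, huu'⟩
      · rintro ⟨u', o⟩ ⟨-, hc, hs⟩
        cases hs with
        | leave _ _ hb' => exact absurd hb hb'
        | follow _ w _ _ hw =>
          obtain ⟨u, huw, huu'⟩ := hc w n rfl
          exact ⟨w, hw, ih huu' huw⟩

namespace RForm

/-- The propositional variables occurring in a formula. -/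
def vars {A P : Type} : RForm A P → Set P
  | atom p => {p}
  | neg φ => φ.vars
  | and φ ψ => φ.vars ∪ ψ.vars
  | box _ φ => φ.vars
  | rall _ φ => φ.vars

/-- The agents of the boxes occurring in a formula. -/
def boxAgents {A P : Type} : RForm A P → Set A
  | atom _ => ∅
  | neg φ => φ.boxAgents
  | and φ ψ => φ.boxAgents ∪ ψ.boxAgents
  | box a φ => insert a φ.boxAgents
  | rall _ φ => φ.boxAgents

/-- The maximal nesting of boxes in a formula. -/
def depth {A P : Type} : RForm A P → ℕ
  | atom _ => 0
  | neg φ => φ.depth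
  | and φ ψ => max φ.depth ψ.depth
  | box _ φ => φ.depth + 1
  | rall _ φ => φ.depth

theorem finite_vars {A P : Type} (φ : RForm A P) : φ.vars.Finite := by
  induction φ with
  | atom p => exact Set.finite_singleton p
  | and φ ψ hφ hψ => exact hφ.union hψ
  | neg φ h | box a φ h | rall a φ h => exact h

theorem finite_boxAgents {A P : Type} (φ : RForm A P) : φ.boxAgents.Finite := by
  induction φ with
  | atom p => exact Set.finite_empty
  | and φ ψ hφ hψ => exact hφ.union hψ
  | box a φ h => exact h.insert a
  | neg φ h | rall a φ h => exact h

theorem nonempty_vars {A P : Type} (φ : RForm A P) : φ.vars.Nonempty := by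
  induction φ with
  | atom p => exact Set.singleton_nonempty p
  | and φ ψ hφ hψ => exact hφ.inl
  | neg φ h | box a φ h | rall a φ h => exact h

end RForm

/-- Formulas of refinement modal logic are invariant under `n`-bisimilarity for large `n`. -/
theorem NBisim.sat_iff {A P : Type} {Q : Set P} {B : Set A} (φ : RForm A P) (hQ : φ.vars ⊆ Q)
    (hB : φ.boxAgents ⊆ B) {n : ℕ} (hn : φ.depth ≤ n) {M N : KModel A P} {s : M.S} {t : N.S}
    (h : NBisim Q B M N n s t) : Sat M s φ ↔ Sat N t φ := by
  induction φ generalizing n M N with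
  | atom p => exact h.atoms p (hQ rfl)
  | neg φ ih => exact not_congr (ih hQ hB hn h)
  | and φ ψ hφ hψ =>
    obtain ⟨hQφ, hQψ⟩ := Set.union_subset_iff.1 hQ
    obtain ⟨hBφ, hBψ⟩ := Set.union_subset_iff.1 hB
    exact and_congr (hφ hQφ hBφ (le_of_max_le_left hn) h) (hψ hQψ hBψ (le_of_max_le_right hn) h)
  | box a φ ih =>
    obtain ⟨ha, hB⟩ := Set.insert_subset_iff.1 hB
    obtain _ | n := n
    · exact absurd hn (Nat.not_succ_le_zero _)
    have hn := Nat.le_of_succ_le_succ hn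
    constructor
    · intro hs t' ht
      obtain ⟨s', hs', hst⟩ := (h.2 a ha).2 t' ht
      exact (ih hQ hB hn hst).1 (hs s' hs')
    · intro ht s' hs
      obtain ⟨t', ht', hst⟩ := (h.2 a ha).1 s' hs
      exact (ih hQ hB hn hst).2 (ht t' ht')
  | rall a φ ih =>
    constructor
    · intro hs N' t' hr
      obtain ⟨M', s', hr', hb⟩ := h.symm.transfer_refines hr
      exact (ih hQ hB hn hb).2 (hs M' s' hr')
    · intro ht M' s' hr
      obtain ⟨N', t', hr', hb⟩ := h.transfer_refines hr
      exact (ih hQ hB hn hb).2 (ht N' t' hr')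

theorem exists_rallFree_tautology {A P : Type} [Nonempty P] :
    ∃ τ : RForm A P, rallFree τ ∧ Valid τ := by
  obtain ⟨p⟩ := ‹Nonempty P›
  exact ⟨.neg (.and (.atom p) (.neg (.atom p))), ⟨trivial, trivial⟩, fun M s h => h.2 h.1⟩

theorem exists_rallFree_disjunction {A P : Type} [Nonempty P] {T : Set (RForm A P)}
    (hfin : T.Finite) (hT : ∀ τ ∈ T, rallFree τ) :
    ∃ ψ : RForm A P, rallFree ψ ∧
      ∀ (M : KModel A P) (s : M.S), Sat M s ψ ↔ ∃ τ ∈ T, Sat M s τ := by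
  induction T, hfin using Set.Finite.induction_on with
  | empty =>
    obtain ⟨τ, hτ, hv⟩ := exists_rallFree_tautology (A := A) (P := P)
    exact ⟨.neg τ, hτ, fun M s => by simpa [Sat] using hv M s⟩
  | @insert χ T _ _ ih =>
    obtain ⟨ψ, hψ, hs⟩ := ih fun τ hτ => hT τ (.inr hτ)
    refine ⟨.neg (.and (.neg χ) (.neg ψ)), ⟨hT χ (.inl rfl), hψ⟩, fun M s => ?_⟩
    simp only [Sat, hs, Set.exists_mem_insert]
    exact or_iff_not_and_not.symm

/-- The truth values of finitely many formulas are captured by finitely many formulas, at least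
one of which is true at each pointed model. -/
theorem exists_finite_rallFree_cover {A P : Type} [Nonempty P] {L : Set (RForm A P)}
    (hfin : L.Finite) (hL : ∀ χ ∈ L, rallFree χ) :
    ∃ T : Set (RForm A P), T.Finite ∧ (∀ τ ∈ T, rallFree τ) ∧
      (∀ (M : KModel A P) (s : M.S), ∃ τ ∈ T, Sat M s τ) ∧
      ∀ τ ∈ T, ∀ (M N : KModel A P) (s : M.S) (t : N.S), Sat M s τ → Sat N t τ →
        ∀ χ ∈ L, Sat M s χ ↔ Sat N t χ := by
  induction L, hfin using Set.Finite.induction_on with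
  | empty =>
    obtain ⟨τ, hτ, hv⟩ := exists_rallFree_tautology (A := A) (P := P)
    refine ⟨{τ}, Set.finite_singleton τ, ?_, fun M s => ⟨τ, rfl, hv M s⟩, by simp⟩
    rintro _ rfl
    exact hτ
  | @insert χ L _ _ ih =>
    obtain ⟨T, hfin, hfree, hcover, hdet⟩ := ih fun τ hτ => hL τ (.inr hτ)
    have hχ := hL χ (.inl rfl)
    refine ⟨.and χ '' T ∪ .and (.neg χ) '' T, (hfin.image _).union (hfin.image _), ?_, ?_, ?_⟩
    · rintro _ (⟨τ, hτ, rfl⟩ | ⟨τ, hτ, rfl⟩)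
      · exact ⟨hχ, hfree τ hτ⟩
      · exact ⟨hχ, hfree τ hτ⟩
    · intro M s
      obtain ⟨τ, hτ, hs⟩ := hcover M s
      by_cases h : Sat M s χ
      · exact ⟨_, .inl ⟨τ, hτ, rfl⟩, h, hs⟩
      · exact ⟨_, .inr ⟨τ, hτ, rfl⟩, h, hs⟩
    · rintro _ (⟨τ, hτ, rfl⟩ | ⟨τ, hτ, rfl⟩) M N s t ⟨hs, hsτ⟩ ⟨ht, htτ⟩ χ' (rfl | hχ')
      · exact iff_of_true hs ht
      · exact hdet τ hτ M N s t hsτ htτ χ' hχ'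
      · exact iff_of_false hs ht
      · exact hdet τ hτ M N s t hsτ htτ χ' hχ'

/-- Agreement on a suitable finite set of formulas of basic modal logic implies
`n`-bisimilarity. -/
theorem exists_finite_rallFree_nbisim {A P : Type} [Nonempty P] {Q : Set P} {B : Set A}
    (hQ : Q.Finite) (hB : B.Finite) (n : ℕ) :
    ∃ L : Set (RForm A P), L.Finite ∧ (∀ χ ∈ L, rallFree χ) ∧
      ∀ (M N : KModel A P) (s : M.S) (t : N.S),
        (∀ χ ∈ L, Sat M s χ ↔ Sat N t χ) → NBisim Q B M N n s t := by
  induction n with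
  | zero =>
    refine ⟨.atom '' Q, hQ.image _, ?_, fun M N s t h p hp => h _ ⟨p, hp, rfl⟩⟩
    rintro _ ⟨p, -, rfl⟩
    trivial
  | succ n ih =>
    obtain ⟨L, hLfin, hLfree, hL⟩ := ih
    obtain ⟨T, hTfin, hTfree, hcover, hdet⟩ := exists_finite_rallFree_cover hLfin hLfree
    refine ⟨.atom '' Q ∪ Set.image2 (fun b τ => .box b (.neg τ)) B T,
      (hQ.image _).union (hB.image2 _ hTfin), ?_, ?_⟩
    · rintro _ (⟨p, -, rfl⟩ | ⟨b, -, τ, hτ, rfl⟩)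
      · trivial
      · exact hTfree τ hτ
    · have forth : ∀ (M N : KModel A P) (s : M.S) (t : N.S) (b : A),
          (∀ τ ∈ T, Sat N t (.box b (.neg τ)) → Sat M s (.box b (.neg τ))) →
          ∀ s', M.R b s s' → ∃ t', N.R b t t' ∧ NBisim Q B M N n s' t' := by
        intro M N s t b h s' hs
        obtain ⟨τ, hτ, hsτ⟩ := hcover M s'
        by_contra! hno
        exact h τ hτ (fun t' ht htτ => hno t' ht (hL _ _ _ _ (hdet τ hτ _ _ _ _ hsτ htτ))) s' hs hsτ
      intro M N s t h
      have hbox : ∀ b ∈ B, ∀ τ ∈ T, Sat M s (.box b (.neg τ)) ↔ Sat N t (.box b (.neg τ)) :=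
        fun b hb τ hτ => h _ (.inr ⟨b, hb, τ, hτ, rfl⟩)
      refine ⟨fun p hp => h _ (.inl ⟨p, hp, rfl⟩), fun b hb =>
        ⟨forth M N s t b fun τ hτ => (hbox b hb τ hτ).2, fun t' ht => ?_⟩⟩
      obtain ⟨s', hs, hst⟩ := forth N M t s b (fun τ hτ => (hbox b hb τ hτ).1) t' ht
      exact ⟨s', hs, hst.symm⟩

/-- Refinement modal logic is equally expressive as basic modal logic: every formula of
`L_∀` is logically equivalent to a `∀`-free formula. -/
theorem RML_equally_expressive {A P : Type} (φ : RForm A P) :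
    ∃ ψ : RForm A P, rallFree ψ ∧
      ∀ (M : KModel A P) (s : M.S), Sat M s φ ↔ Sat M s ψ := by
  have : Nonempty P := φ.nonempty_vars.to_subtype.map Subtype.val
  obtain ⟨L, hLfin, hLfree, hL⟩ :=
    exists_finite_rallFree_nbisim φ.finite_vars φ.finite_boxAgents φ.depth
  obtain ⟨T, hTfin, hTfree, hcover, hdet⟩ := exists_finite_rallFree_cover hLfin hLfree
  obtain ⟨ψ, hψ, hs⟩ := exists_rallFree_disjunction
    (T := {τ ∈ T | ∃ (N : KModel A P) (t : N.S), Sat N t τ ∧ Sat N t φ})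
    (hTfin.subset (Set.sep_subset _ _)) fun τ hτ => hTfree τ hτ.1
  refine ⟨ψ, hψ, fun M s => ⟨fun h => ?_, fun h => ?_⟩⟩
  · obtain ⟨τ, hτ, hsτ⟩ := hcover M s
    exact (hs M s).2 ⟨τ, ⟨hτ, M, s, hsτ, h⟩, hsτ⟩
  · obtain ⟨τ, ⟨hτ, N, t, htτ, ht⟩, hsτ⟩ := (hs M s).1 h
    exact (NBisim.sat_iff φ subset_rfl subset_rfl le_rfl
      (hL _ _ _ _ (hdet τ hτ _ _ _ _ htτ hsτ))).1 ht
end
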